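/- Failure of strong unique continuation with L^p potential for p < 2: Fix 0 < p < 2 and ε ∈ (0, (2−p)/p) (so that (ε+1)p < 2). Define u_ε : ℂ → ℂ by u_ε(z) = e^{−1/|z|^ε} for z ≠ 0 and u_ε(0) = 0, and define V(z) = ε/(2|z|^{ε+1}) for z ≠ 0. Then: (i) u_ε vanishes to infinite order at 0, i.e. for every m ≥ 0, lim_{r→0⁺} r^{−m} ∫_{|z|<r} |u_ε(z)|² dv_z = 0; (ii) u_ε is differentiable on ℂ \ {0} and satisfies |∂̄u_ε(z)| = V(z)|u_ε(z)| for every z ≠ 0, where ∂̄ = (∂_x + i∂_y)/2; and (iii) V ∈ L^p(D₁), i.e. ∫_{|z|<1} V(z)^p dv_z < ∞. -/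

import Mathlib

open MeasureTheory Metric Filter Topology

/-- The (pointwise) `∂̄`-operator: `∂̄u(z) = (∂_x u(z) + i ∂_y u(z))/2`, computed from the
real Fréchet derivative. -/
noncomputable def dbar (u : ℂ → ℂ) (z : ℂ) : ℂ :=
  (fderiv ℝ u z 1 + Complex.I * fderiv ℝ u z Complex.I) / 2

/-- The function `u_ε(z) = e^{−1/|z|^ε}` for `z ≠ 0`, `u_ε(0) = 0`. -/
noncomputable def uEps (ε : ℝ) (z : ℂ) : ℂ :=
  if z = 0 then 0 else ((Real.exp (-1 / ‖z‖ ^ ε) : ℝ) : ℂ)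

/-- The potential `V(z) = ε/(2|z|^{ε+1})`. -/
noncomputable def VEps (ε : ℝ) (z : ℂ) : ℝ :=
  ε / (2 * ‖z‖ ^ (ε + 1))

lemma uEps_of_ne_zero {ε : ℝ} {z : ℂ} (hz : z ≠ 0) :
    uEps ε z = ((Real.exp (-(‖z‖ ^ 2) ^ (-ε / 2)) : ℝ) : ℂ) := by
  have h : (‖z‖ ^ 2) ^ (-ε / 2) = (‖z‖ ^ ε)⁻¹ := by
    rw [← Real.rpow_natCast, ← Real.rpow_mul (norm_nonneg z), ← Real.rpow_neg (norm_nonneg z)]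
    congr 1
    push_cast
    ring
  rw [uEps, if_neg hz, h, neg_div, one_div]

lemma norm_uEps_sq_le {ε r : ℝ} (hε : 0 < ε) {z : ℂ} (hz : z ∈ ball (0 : ℂ) r) :
    ‖uEps ε z‖ ^ 2 ≤ Real.exp (-r ^ (-ε)) := by
  rcases eq_or_ne z 0 with rfl | h0
  · simp [uEps, Real.exp_nonneg]
  have hz0 : 0 < ‖z‖ := norm_pos_iff.2 h0
  have hzr : ‖z‖ ≤ r := (mem_ball_zero_iff.1 hz).le
  have hle : r ^ (-ε) ≤ ‖z‖ ^ (-ε) := Real.rpow_le_rpow_of_nonpos hz0 hzr (neg_nonpos.2 hε.le)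
  have hpos : 0 < ‖z‖ ^ (-ε) := Real.rpow_pos_of_pos hz0 _
  rw [uEps, if_neg h0, Complex.norm_real, Real.norm_of_nonneg (Real.exp_nonneg _),
    ← Real.exp_nat_mul, neg_div, one_div, ← Real.rpow_neg hz0.le, Real.exp_le_exp]
  push_cast
  linarith

lemma tendsto_exp_neg_rpow_neg_div_pow {ε : ℝ} (hε : 0 < ε) (m : ℕ) :
    Tendsto (fun r : ℝ => Real.exp (-r ^ (-ε)) / r ^ m) (𝓝[>] (0 : ℝ)) (𝓝 0) := by
  have h := (tendsto_rpow_mul_exp_neg_mul_atTop_nhds_zero (m / ε) 1 one_pos).comp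
    (tendsto_rpow_neg_nhdsGT_zero (neg_neg_of_pos hε))
  refine h.congr' ?_
  filter_upwards [self_mem_nhdsWithin] with r hr
  have hr : 0 < r := hr
  have hexp : -ε * (m / ε) = -(m : ℝ) := by field_simp
  rw [Function.comp_apply, ← Real.rpow_mul hr.le, hexp, Real.rpow_neg hr.le, Real.rpow_natCast,
    neg_one_mul, div_eq_inv_mul]

/-- `u_ε` vanishes to infinite order at the origin. -/
lemma tendsto_integral_norm_uEps_sq_div_pow {ε : ℝ} (hε : 0 < ε) (m : ℕ) :
    Tendsto (fun r : ℝ => (∫ z in ball (0 : ℂ) r, ‖uEps ε z‖ ^ 2) / r ^ m)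
      (𝓝[>] (0 : ℝ)) (𝓝 0) := by
  have hlim := (tendsto_exp_neg_rpow_neg_div_pow hε m).mul_const (volume.real (ball (0 : ℂ) 1))
  rw [zero_mul] at hlim
  refine squeeze_zero' ?_ ?_ hlim
  · filter_upwards [self_mem_nhdsWithin] with r hr
    have hr : 0 < r := hr
    positivity
  · filter_upwards [Ioo_mem_nhdsGT one_pos] with r hr
    have hr0 : 0 < r := hr.1
    have hint : ∫ z in ball (0 : ℂ) r, ‖uEps ε z‖ ^ 2
        ≤ Real.exp (-r ^ (-ε)) * volume.real (ball (0 : ℂ) r) := by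
      refine (Real.le_norm_self _).trans (norm_setIntegral_le_of_norm_le_const measure_ball_lt_top ?_)
      intro z hz
      rw [Real.norm_of_nonneg (by positivity)]
      exact norm_uEps_sq_le hε hz
    have hvol : volume.real (ball (0 : ℂ) r) ≤ volume.real (ball (0 : ℂ) 1) :=
      measureReal_mono (ball_subset_ball hr.2.le) measure_ball_lt_top.ne
    rw [div_mul_eq_mul_div]
    gcongr
    exact hint.trans (by gcongr)

lemma hasFDerivAt_uEps {ε : ℝ} {z : ℂ} (hz : z ≠ 0) :
    HasFDerivAt (uEps ε) (Complex.ofRealCLM.comp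
      ((Real.exp (-(‖z‖ ^ 2) ^ (-ε / 2)) * -(-ε / 2 * (‖z‖ ^ 2) ^ (-ε / 2 - 1))) •
        (2 • innerSL ℝ z))) z := by
  have hne : ‖z‖ ^ 2 ≠ 0 := by positivity
  have hprofile : HasDerivAt (fun s : ℝ => Real.exp (-s ^ (-ε / 2)))
      (Real.exp (-(‖z‖ ^ 2) ^ (-ε / 2)) * -(-ε / 2 * (‖z‖ ^ 2) ^ (-ε / 2 - 1))) (‖z‖ ^ 2) :=
    (Real.hasDerivAt_rpow_const (Or.inl hne)).neg.exp
  have hcomp := hprofile.comp_hasFDerivAt z (hasStrictFDerivAt_norm_sq z).hasFDerivAt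
  refine (Complex.ofRealCLM.hasFDerivAt.comp z hcomp).congr_of_eventuallyEq ?_
  filter_upwards [isOpen_ne.mem_nhds hz] with w hw
  simpa using uEps_of_ne_zero hw

lemma dbar_uEps {ε : ℝ} {z : ℂ} (hz : z ≠ 0) :
    dbar (uEps ε) z =
      ((ε / 2 * (‖z‖ ^ 2) ^ (-ε / 2 - 1) * Real.exp (-(‖z‖ ^ 2) ^ (-ε / 2)) : ℝ) : ℂ) * z := by
  rw [dbar, (hasFDerivAt_uEps hz).fderiv]
  apply Complex.ext <;> simp [Complex.inner] <;> ring

lemma norm_dbar_uEps {ε : ℝ} (hε : 0 < ε) {z : ℂ} (hz : z ≠ 0) :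
    ‖dbar (uEps ε) z‖ = VEps ε z * ‖uEps ε z‖ := by
  have hz0 : 0 < ‖z‖ := norm_pos_iff.2 hz
  have hpow : (‖z‖ ^ 2) ^ (-ε / 2 - 1) * ‖z‖ = (‖z‖ ^ (ε + 1))⁻¹ := by
    rw [← Real.rpow_natCast, ← Real.rpow_mul hz0.le, ← Real.rpow_add_one hz0.ne',
      ← Real.rpow_neg hz0.le]
    congr 1
    push_cast
    ring
  rw [dbar_uEps hz, uEps_of_ne_zero hz, norm_mul, Complex.norm_real, Complex.norm_real,
    Real.norm_of_nonneg (by positivity), Real.norm_of_nonneg (Real.exp_nonneg _), VEps,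
    div_mul_eq_div_div, div_eq_mul_inv (ε / 2), ← hpow]
  ring

lemma VEps_rpow {ε : ℝ} (hε : 0 < ε) (p : ℝ) (z : ℂ) :
    VEps ε z ^ p = (ε / 2) ^ p * ‖z‖ ^ (-((ε + 1) * p)) := by
  rw [VEps, div_mul_eq_div_div, Real.div_rpow (by positivity) (by positivity),
    ← Real.rpow_mul (norm_nonneg z), Real.rpow_neg (norm_nonneg z), div_eq_mul_inv]

/-- `V` belongs to `L^p` of the unit disc as soon as `(ε + 1) p < 2`. -/
lemma lintegral_VEps_rpow_lt_top {p ε : ℝ} (hε : 0 < ε) (h : (ε + 1) * p < 2) :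
    (∫⁻ z in ball (0 : ℂ) 1, ENNReal.ofReal (VEps ε z ^ p)) < ⊤ := by
  have hmeas : Measurable fun z : ℂ => VEps ε z ^ p := by
    unfold VEps
    fun_prop
  have hint : IntegrableOn (fun z : ℂ => VEps ε z ^ p) (ball 0 1) := by
    refine integrableOn_ball_of_norm_le_rpow (C := (ε / 2) ^ p) (α := (ε + 1) * p)
      (by simp) (by simpa using h) (.of_forall fun z => ?_) hmeas.aestronglyMeasurable
    rw [← VEps_rpow hε, Real.norm_of_nonneg]
    rw [VEps_rpow hε]
    positivity
  exact hint.lintegral_lt_top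

/-- **Failure of strong unique continuation with `L^p` potential for `p < 2`.**
Fix `0 < p < 2` and `ε ∈ (0, (2−p)/p)`.  Then `u_ε(z) = e^{−1/|z|^ε}` (extended by `0` at the
origin) (i) vanishes to infinite order at `0`; (ii) is differentiable away from `0` and
satisfies `|∂̄u_ε(z)| = V(z)|u_ε(z)|` for `z ≠ 0` with `V(z) = ε/(2|z|^{ε+1})`; and
(iii) `V ∈ L^p(D₁)`. -/
theorem failure_sucp_Lp_potential (p ε : ℝ) (hp0 : 0 < p) (hp2 : p < 2)
    (hε0 : 0 < ε) (hε : ε < (2 - p) / p) :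
    (∀ m : ℕ, Tendsto (fun r : ℝ => (∫ z in ball (0 : ℂ) r, ‖uEps ε z‖ ^ 2) / r ^ m)
        (𝓝[>] (0 : ℝ)) (𝓝 0)) ∧
    (∀ z : ℂ, z ≠ 0 →
        DifferentiableAt ℝ (uEps ε) z ∧ ‖dbar (uEps ε) z‖ = VEps ε z * ‖uEps ε z‖) ∧
    (∫⁻ z in ball (0 : ℂ) 1, ENNReal.ofReal (VEps ε z ^ p)) < ⊤ := by
  refine ⟨tendsto_integral_norm_uEps_sq_div_pow hε0,
    fun z hz => ⟨(hasFDerivAt_uEps hz).differentiableAt, norm_dbar_uEps hε0 hz⟩,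
    lintegral_VEps_rpow_lt_top hε0 ?_⟩
  rw [lt_div_iff₀ hp0] at hε
  linarith
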